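/- Let Ψ, Ω : ℝ × ℝ² → ℝ be smooth with ΔΨ(t,·) = Ω(t,·) for every t and with Ω solving the 2D Euler equation ∂ₜΩ + {Ψ,Ω} = 0. Assume the transport equation has the uniqueness property: any smooth ψ : ℝ × ℝ² → ℂ satisfying ∂ₜψ + {Ψ,ψ} = 0 and ψ(0,·) ≡ 0 vanishes identically. Let λ ∈ ℂ and let φ : ℝ × ℝ² → ℂ be a smooth solution of ∂ₜφ + {Ψ,φ} = 0 whose initial datum is an eigenfunction: {Ω(0,·), φ(0,·)} = λ φ(0,·). Then for every time t one has {Ω(t,·), φ(t,·)} = λ φ(t,·); i.e., the eigenvalue λ of the operator L = {Ω, ·} is preserved under the 2D Euler flow (isospectrality of the Lax pair). -/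

import Mathlib

/-- Partial derivative in time for a function of `(t, x)`. -/
noncomputable def pdt {X E : Type*} [NormedAddCommGroup E] [NormedSpace ℝ E]
    (f : ℝ × X → E) (q : ℝ × X) : E :=
  deriv (fun s => f (s, q.2)) q.1

/-- Partial derivative in the first spatial variable. -/
noncomputable def pdx {E : Type*} [NormedAddCommGroup E] [NormedSpace ℝ E]
    (f : ℝ × ℝ → E) (p : ℝ × ℝ) : E :=
  deriv (fun x => f (x, p.2)) p.1

/-- Partial derivative in the second spatial variable. -/
noncomputable def pdy {E : Type*} [NormedAddCommGroup E] [NormedSpace ℝ E]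
    (f : ℝ × ℝ → E) (p : ℝ × ℝ) : E :=
  deriv (fun y => f (p.1, y)) p.2

/-- The bracket `{f,g} = (∂ₓf)(∂_y g) − (∂_y f)(∂ₓ g)`. -/
noncomputable def bracket {𝕜 : Type*} [NormedCommRing 𝕜] [NormedSpace ℝ 𝕜]
    (f g : ℝ × ℝ → 𝕜) (p : ℝ × ℝ) : 𝕜 :=
  pdx f p * pdy g p - pdy f p * pdx g p

noncomputable def DD (v : ℝ × (ℝ × ℝ)) (f : ℝ × (ℝ × ℝ) → ℂ) (q : ℝ × (ℝ × ℝ)) : ℂ :=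
  fderiv ℝ f q v

theorem DD_smooth (v : ℝ × (ℝ × ℝ)) {f : ℝ × (ℝ × ℝ) → ℂ} (hf : ContDiff ℝ (⊤ : ℕ∞) f) :
    ContDiff ℝ (⊤ : ℕ∞) (DD v f) :=
  (hf.fderiv_right (m := ((⊤ : ℕ∞) : WithTop ℕ∞)) (by simp)).clm_apply contDiff_const

theorem smooth_diff {f : ℝ × (ℝ × ℝ) → ℂ} (hf : ContDiff ℝ (⊤ : ℕ∞) f) (q) :
    DifferentiableAt ℝ f q := (hf.differentiable (by simp)) q

theorem DD_mul (v : ℝ × (ℝ × ℝ)) {f g : ℝ × (ℝ × ℝ) → ℂ} (hf : ContDiff ℝ (⊤ : ℕ∞) f)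
    (hg : ContDiff ℝ (⊤ : ℕ∞) g) (q) :
    DD v (fun z => f z * g z) q = f q * DD v g q + DD v f q * g q := by
  unfold DD
  rw [fderiv_fun_mul (smooth_diff hf q) (smooth_diff hg q)]
  simp [mul_comm]

theorem DD_sub (v : ℝ × (ℝ × ℝ)) {f g : ℝ × (ℝ × ℝ) → ℂ} (hf : ContDiff ℝ (⊤ : ℕ∞) f)
    (hg : ContDiff ℝ (⊤ : ℕ∞) g) (q) :
    DD v (fun z => f z - g z) q = DD v f q - DD v g q := by
  unfold DD
  rw [fderiv_fun_sub (smooth_diff hf q) (smooth_diff hg q)]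
  simp

theorem DD_const_mul (v : ℝ × (ℝ × ℝ)) (c : ℂ) {g : ℝ × (ℝ × ℝ) → ℂ}
    (hg : ContDiff ℝ (⊤ : ℕ∞) g) (q) :
    DD v (fun z => c * g z) q = c * DD v g q := by
  unfold DD
  rw [fderiv_const_mul (smooth_diff hg q)]
  simp

theorem DD_comm (v w : ℝ × (ℝ × ℝ)) {f : ℝ × (ℝ × ℝ) → ℂ} (hf : ContDiff ℝ (⊤ : ℕ∞) f) (q) :
    DD v (DD w f) q = DD w (DD v f) q := by
  have h1 : DifferentiableAt ℝ (fderiv ℝ f) q :=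
    (hf.fderiv_right (m := ((⊤ : ℕ∞) : WithTop ℕ∞)) (by simp)).differentiable (by simp) q
  have key : ∀ a b, DD a (DD b f) q = fderiv ℝ (fderiv ℝ f) q a b := by
    intro a b
    have := (h1.hasFDerivAt.clm_apply (hasFDerivAt_const b q)).fderiv
    change fderiv ℝ (fun z => fderiv ℝ f z b) q a = _
    rw [this]; simp
  rw [key, key]
  have hs : IsSymmSndFDerivAt ℝ f q := hf.contDiffAt.isSymmSndFDerivAt (by
    rw [minSmoothness_of_isRCLikeNormedField]; exact WithTop.coe_le_coe.mpr (le_top : (2 : ℕ∞) ≤ ⊤))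
  exact hs v w

theorem pdt_eq {E : Type*} [NormedAddCommGroup E] [NormedSpace ℝ E]
    {f : ℝ × (ℝ × ℝ) → E} (hf : Differentiable ℝ f) (t : ℝ) (p : ℝ × ℝ) :
    pdt f (t, p) = fderiv ℝ f (t, p) (1, (0, 0)) := by
  have h : HasDerivAt (fun s : ℝ => (s, p)) ((1 : ℝ), ((0 : ℝ), (0 : ℝ))) t :=
    (hasDerivAt_id t).prodMk (hasDerivAt_const t p)
  exact ((hf (t, p)).hasFDerivAt.comp_hasDerivAt t h).deriv

theorem pdx_eq {E : Type*} [NormedAddCommGroup E] [NormedSpace ℝ E]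
    {f : ℝ × (ℝ × ℝ) → E} (hf : Differentiable ℝ f) (t : ℝ) (p : ℝ × ℝ) :
    pdx (fun r => f (t, r)) p = fderiv ℝ f (t, p) (0, (1, 0)) := by
  have h : HasDerivAt (fun s : ℝ => (t, (s, p.2))) ((0 : ℝ), ((1 : ℝ), (0 : ℝ))) p.1 :=
    (hasDerivAt_const _ t).prodMk ((hasDerivAt_id _).prodMk (hasDerivAt_const _ p.2))
  exact ((hf (t, p)).hasFDerivAt.comp_hasDerivAt p.1 h).deriv

theorem pdy_eq {E : Type*} [NormedAddCommGroup E] [NormedSpace ℝ E]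
    {f : ℝ × (ℝ × ℝ) → E} (hf : Differentiable ℝ f) (t : ℝ) (p : ℝ × ℝ) :
    pdy (fun r => f (t, r)) p = fderiv ℝ f (t, p) (0, (0, 1)) := by
  have h : HasDerivAt (fun s : ℝ => (t, (p.1, s))) ((0 : ℝ), ((0 : ℝ), (1 : ℝ))) p.2 :=
    (hasDerivAt_const _ t).prodMk ((hasDerivAt_const _ p.1).prodMk (hasDerivAt_id _))
  exact ((hf (t, p)).hasFDerivAt.comp_hasDerivAt p.2 h).deriv

theorem DD_ofReal (v : ℝ × (ℝ × ℝ)) {f : ℝ × (ℝ × ℝ) → ℝ} (hf : Differentiable ℝ f) (q) :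
    DD v (fun z => (f z : ℂ)) q = ((fderiv ℝ f q v : ℝ) : ℂ) := by
  have := (Complex.ofRealCLM.hasFDerivAt.comp q (hf q).hasFDerivAt).fderiv
  change fderiv ℝ (Complex.ofRealCLM ∘ f) q v = _
  rw [this]; simp

theorem bracket_eq {f g : ℝ × (ℝ × ℝ) → ℂ} (hf : ContDiff ℝ (⊤ : ℕ∞) f)
    (hg : ContDiff ℝ (⊤ : ℕ∞) g) (t : ℝ) (p : ℝ × ℝ) :
    bracket (fun r => f (t, r)) (fun r => g (t, r)) p =
      DD (0, (1, 0)) f (t, p) * DD (0, (0, 1)) g (t, p)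
        - DD (0, (0, 1)) f (t, p) * DD (0, (1, 0)) g (t, p) := by
  have h1 : Differentiable ℝ f := smooth_diff hf
  have h2 : Differentiable ℝ g := smooth_diff hg
  unfold bracket DD
  rw [pdx_eq h1, pdx_eq h2, pdy_eq h1, pdy_eq h2]

/-- Isospectrality of the Lax pair of the 2D Euler equation: if `φ` solves the second
Lax equation and its initial datum is an eigenfunction of `L = {Ω(0,·), ·}` with
eigenvalue `λ`, then `φ(t,·)` is an eigenfunction of `L = {Ω(t,·), ·}` with the same
eigenvalue `λ` for every time `t`. -/
theorem laxPair_2d_isospectral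
    (Ψ Ω : ℝ × (ℝ × ℝ) → ℝ)
    (hΨ : ContDiff ℝ (⊤ : ℕ∞) Ψ) (hΩ : ContDiff ℝ (⊤ : ℕ∞) Ω)
    (hlap : ∀ t p, pdx (pdx (fun q => Ψ (t, q))) p + pdy (pdy (fun q => Ψ (t, q))) p = Ω (t, p))
    (heuler : ∀ t p,
      pdt Ω (t, p) + bracket (fun q => Ψ (t, q)) (fun q => Ω (t, q)) p = 0)
    (huniq : ∀ ψ : ℝ × (ℝ × ℝ) → ℂ, ContDiff ℝ (⊤ : ℕ∞) ψ →
      (∀ t p, pdt ψ (t, p) + bracket (fun q => (Ψ (t, q) : ℂ)) (fun q => ψ (t, q)) p = 0) →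
      (∀ p, ψ (0, p) = 0) → ∀ q, ψ q = 0)
    (lam : ℂ) (φ : ℝ × (ℝ × ℝ) → ℂ) (hφ : ContDiff ℝ (⊤ : ℕ∞) φ)
    (hlax : ∀ t p,
      pdt φ (t, p) + bracket (fun q => (Ψ (t, q) : ℂ)) (fun q => φ (t, q)) p = 0)
    (hinit : ∀ p, bracket (fun r => (Ω (0, r) : ℂ)) (fun r => φ (0, r)) p = lam * φ (0, p)) :
    ∀ t p, bracket (fun r => (Ω (t, r) : ℂ)) (fun r => φ (t, r)) p = lam * φ (t, p) := by
  set e0 : ℝ × (ℝ × ℝ) := (1, (0, 0)) with he0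
  set e1 : ℝ × (ℝ × ℝ) := (0, (1, 0)) with he1
  set e2 : ℝ × (ℝ × ℝ) := (0, (0, 1)) with he2
  obtain ⟨P, hPdef⟩ : ∃ P : ℝ × (ℝ × ℝ) → ℂ, P = fun z => (Ψ z : ℂ) := ⟨_, rfl⟩
  obtain ⟨W, hWdef⟩ : ∃ W : ℝ × (ℝ × ℝ) → ℂ, W = fun z => (Ω z : ℂ) := ⟨_, rfl⟩
  have hP : ContDiff ℝ (⊤ : ℕ∞) P := by
    rw [hPdef]; exact Complex.ofRealCLM.contDiff.comp hΨ
  have hW : ContDiff ℝ (⊤ : ℕ∞) W := by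
    rw [hWdef]; exact Complex.ofRealCLM.contDiff.comp hΩ
  have dΨ : Differentiable ℝ Ψ := hΨ.differentiable (by simp)
  have dΩ : Differentiable ℝ Ω := hΩ.differentiable (by simp)
  have eP : ∀ t, (fun q => (Ψ (t, q) : ℂ)) = fun q => P (t, q) := by intro t; rw [hPdef]
  have eW : ∀ t, (fun q => (Ω (t, q) : ℂ)) = fun q => W (t, q) := by intro t; rw [hWdef]
  simp only [eP] at huniq hlax
  simp only [eW] at hinit ⊢
  have tW : DD e0 W = fun z => DD e2 P z * DD e1 W z - DD e1 P z * DD e2 W z := by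
    funext ⟨t, p⟩
    have h := heuler t p
    unfold bracket at h
    rw [pdt_eq dΩ, pdx_eq dΨ, pdx_eq dΩ, pdy_eq dΨ, pdy_eq dΩ] at h
    rw [hPdef, hWdef]
    simp only [DD_ofReal _ dΨ, DD_ofReal _ dΩ]
    norm_cast
    linarith
  have tφ : DD e0 φ = fun z => DD e2 P z * DD e1 φ z - DD e1 P z * DD e2 φ z := by
    funext ⟨t, p⟩
    have h := hlax t p
    rw [pdt_eq (smooth_diff hφ), bracket_eq hP hφ] at h
    change DD e0 φ (t, p) + _ = 0 at h
    linear_combination h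
  have P1 := DD_smooth e1 hP
  have P2 := DD_smooth e2 hP
  have W1 := DD_smooth e1 hW
  have W2 := DD_smooth e2 hW
  have F1 := DD_smooth e1 hφ
  have F2 := DD_smooth e2 hφ
  have hL : ContDiff ℝ (⊤ : ℕ∞) (fun z => lam * φ z) := contDiff_const.mul hφ
  have hψ : ContDiff ℝ (⊤ : ℕ∞)
      (fun z => (DD e1 W z * DD e2 φ z - DD e2 W z * DD e1 φ z) - lam * φ z) :=
    ((W1.mul F2).sub (W2.mul F1)).sub hL
  have main := huniq _ hψ ?_ ?_
  · intro t p
    rw [bracket_eq hW hφ]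
    exact sub_eq_zero.mp (main (t, p))
  · intro t p
    rw [pdt_eq (smooth_diff hψ), bracket_eq hP hψ]
    change DD e0 _ (t, p) + (DD e1 P (t, p) * DD e2 _ (t, p)
      - DD e2 P (t, p) * DD e1 _ (t, p)) = 0
    have ex : ∀ v, DD v (fun z => (DD e1 W z * DD e2 φ z - DD e2 W z * DD e1 φ z) - lam * φ z)
        (t, p) = (DD e1 W (t, p) * DD v (DD e2 φ) (t, p) + DD v (DD e1 W) (t, p) * DD e2 φ (t, p))
        - (DD e2 W (t, p) * DD v (DD e1 φ) (t, p) + DD v (DD e2 W) (t, p) * DD e1 φ (t, p))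
        - lam * DD v φ (t, p) := by
      intro v
      rw [DD_sub v ((W1.mul F2).sub (W2.mul F1)) hL, DD_sub v (W1.mul F2) (W2.mul F1),
        DD_mul v W1 F2, DD_mul v W2 F1, DD_const_mul v lam hφ]
    rw [ex, ex, ex, DD_comm e0 e1 hW, DD_comm e0 e2 hW, DD_comm e0 e1 hφ, DD_comm e0 e2 hφ,
      tW, tφ]
    rw [DD_sub _ (P2.mul W1) (P1.mul W2), DD_sub _ (P2.mul W1) (P1.mul W2),
      DD_sub _ (P2.mul F1) (P1.mul F2), DD_sub _ (P2.mul F1) (P1.mul F2)]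
    simp only [DD_mul _ P2 W1, DD_mul _ P1 W2, DD_mul _ P2 F1, DD_mul _ P1 F2]
    rw [DD_comm e2 e1 hP, DD_comm e2 e1 hW, DD_comm e2 e1 hφ]
    ring
  · intro p
    have h := hinit p
    rw [bracket_eq hW hφ] at h
    exact sub_eq_zero.mpr h
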